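/- Let k ≥ 2 and l > 3 be natural numbers such that k is even and 3 divides l. Then n(k,l) = (2/3)kl + 1; that is, every element of the alternating group A_{(2kl/3)+1} can be written as a product of k many l-cycles of S_{(2kl/3)+1}, and for every n > (2kl/3)+1 there exists an element of A_n that cannot be written as a product of k many l-cycles of S_n. -/

import Mathlib

open Equiv

/-- `σ ∈ S_n` is a product of `k` many `l`-cycles. -/
def IsProdOfCycles (n k l : ℕ) (σ : Equiv.Perm (Fin n)) : Prop :=
  ∃ c : Fin k → Equiv.Perm (Fin n),
    (∀ i, (c i).IsCycle ∧ (c i).support.card = l) ∧ σ = (List.ofFn c).prod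

lemma ins_left {α : Type*} [DecidableEq α] (L : List α) (hL : L.Nodup) (y p : α) (hy : y ∈ L)
    (hp : p ∉ L) : ∃ L' : List α, L'.Nodup ∧ L'.length = L.length + 1 ∧
      (∀ z, z ∈ L' ↔ z = p ∨ z ∈ L) ∧ L'.formPerm = swap y p * L.formPerm := by
  obtain ⟨s, t, rfl⟩ := List.append_of_mem hy
  have hr : (s ++ y :: t) ~r (y :: t ++ s) := List.isRotated_append
  refine ⟨p :: (y :: t ++ s), ?_, ?_, ?_, ?_⟩
  · refine List.nodup_cons.2 ⟨fun h => hp (hr.mem_iff.2 h), hr.nodup_iff.1 hL⟩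
  · simp; omega
  · intro z
    rw [List.mem_cons, hr.mem_iff]
  · rw [List.formPerm_eq_of_isRotated hL hr, List.cons_append, List.formPerm_cons_cons, swap_comm]

lemma ins_right {α : Type*} [DecidableEq α] (L : List α) (hL : L.Nodup) (x p : α) (hx : x ∈ L)
    (hp : p ∉ L) : ∃ L' : List α, L'.Nodup ∧ L'.length = L.length + 1 ∧
      (∀ z, z ∈ L' ↔ z = p ∨ z ∈ L) ∧ L'.formPerm = L.formPerm * swap x p := by
  obtain ⟨L', h1, h2, h3, h4⟩ := ins_left L hL (L.formPerm x) p
    (List.formPerm_apply_mem_of_mem hx) hp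
  refine ⟨L', h1, h2, h3, ?_⟩
  rw [h4, Equiv.mul_swap_eq_swap_mul, List.formPerm_apply_of_notMem hp]

lemma ct_formPerm {n : ℕ} (L : List (Fin n)) (hL : L.Nodup) :
    L.formPerm.cycleType = Multiset.filter (2 ≤ ·) {L.length} := by
  rcases L with _ | ⟨a, _ | ⟨b, t⟩⟩
  · simp [Multiset.filter_singleton]
  · simp [Multiset.filter_singleton]
  · rw [(List.isCycle_formPerm hL (by simp)).cycleType,
      List.support_formPerm_of_nodup _ hL (by simp), List.toFinset_card_of_nodup hL,
      Multiset.filter_singleton, if_pos (by simp)]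
    

def St (n : ℕ) (M : Multiset ℕ) (r la lb : ℕ) : Prop :=
  ∃ (T : Finset (Fin n)) (L A B : List (Fin n)) (τ : Perm (Fin n)) (x : Fin n),
    T.card = r + M.sum ∧ L.Nodup ∧ A.Nodup ∧ B.Nodup ∧ x ∈ A ∧ x ∈ B ∧ A.formPerm x ∈ L ∧
    (∀ z ∈ L, z ∈ T) ∧ (∀ z ∈ A, z ∈ T) ∧ (∀ z ∈ B, z ∈ T) ∧ L.length = r ∧ A.length = la ∧
    B.length = lb ∧ (∀ z ∈ L, τ z = z) ∧ (∀ z, z ∉ T → τ z = z) ∧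
    τ.cycleType = M.filter (2 ≤ ·) ∧ L.formPerm * τ = A.formPerm * B.formPerm

lemma St.init {n : ℕ} (hn : 0 < n) : St n 0 1 1 1 := by
  have x : Fin n := ⟨0, hn⟩
  exact ⟨{x}, [x], [x], [x], 1, x, by simp⟩

lemma disj_fp {n : ℕ} (L : List (Fin n)) (τ : Perm (Fin n)) (h : ∀ z ∈ L, τ z = z) :
    Perm.Disjoint L.formPerm τ := by
  intro z
  by_cases hz : z ∈ L
  · exact Or.inr (h z hz)
  · exact Or.inl (List.formPerm_apply_of_notMem hz)

lemma fresh {n : ℕ} (T : Finset (Fin n)) (h : T.card < n) : ∃ p, p ∉ T := by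
  by_contra! hc
  have : T = Finset.univ := by ext; simp [hc]
  subst this; simp at h

lemma St.new {n : ℕ} {M : Multiset ℕ} {r la lb : ℕ} (h : St n M r la lb) (hn : r + M.sum < n) :
    St n (r ::ₘ M) 1 (la + 1) (lb + 1) := by
  obtain ⟨T, L, A, B, τ, x, hT, hL, hA, hB, xA, xB, yL, LT, AT, BT, rfl, rfl, rfl, τL, τT, ct, e⟩ := h
  obtain ⟨p, hp⟩ := fresh T (by omega)
  obtain ⟨A', a1, a2, a3, a4⟩ := ins_right A hA x p xA (fun h => hp (AT _ h))
  obtain ⟨B', b1, b2, b3, b4⟩ := ins_left B hB x p xB (fun h => hp (BT _ h))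
  refine ⟨insert p T, [p], A', B', L.formPerm * τ, x, ?_, by simp, a1, b1, by simp [a3, xA],
    by simp [b3, xB], ?_, by simp, ?_, ?_, by simp, a2, b2, ?_, ?_, ?_, ?_⟩
  · rw [Finset.card_insert_of_notMem hp, hT]; simp; omega
  · rw [a4]; simp [List.formPerm_apply_of_notMem (fun h => hp (AT _ h))]
  · intro z hz; rcases (a3 z).1 hz with h | h <;> simp [h, AT]
  · intro z hz; rcases (b3 z).1 hz with h | h <;> simp [h, BT]
  · intro z hz
    simp only [List.mem_singleton] at hz; subst hz
    simp [τT _ hp, List.formPerm_apply_of_notMem (fun h => hp (LT _ h))]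
  · intro z hz
    simp only [Finset.mem_insert, not_or] at hz
    simp [τT _ hz.2, List.formPerm_apply_of_notMem (fun h => hz.2 (LT _ h))]
  · rw [(disj_fp L τ τL).cycleType_mul, ct, ct_formPerm L hL, ← Multiset.singleton_add,
      Multiset.filter_add]
  · rw [a4, b4, e]; simp [mul_assoc]

lemma St.extA {n : ℕ} {M : Multiset ℕ} {r la lb : ℕ} (h : St n M r la lb) (hn : r + M.sum < n) :
    St n M (r + 1) (la + 1) lb := by
  obtain ⟨T, L, A, B, τ, x, hT, hL, hA, hB, xA, xB, yL, LT, AT, BT, rfl, rfl, rfl, τL, τT, ct, e⟩ := h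
  obtain ⟨p, hp⟩ := fresh T (by omega)
  obtain ⟨A', a1, a2, a3, a4⟩ := ins_right A hA x p xA (fun h => hp (AT _ h))
  obtain ⟨L', l1, l2, l3, l4⟩ := ins_left L hL _ p yL (fun h => hp (LT _ h))
  have pA : A.formPerm p = p := List.formPerm_apply_of_notMem (fun h => hp (AT _ h))
  refine ⟨insert p T, L', A', B, τ, x, ?_, l1, a1, hB, by simp [a3, xA],
    xB, ?_, ?_, ?_, ?_, l2, a2, rfl, ?_, ?_, ct, ?_⟩
  · rw [Finset.card_insert_of_notMem hp, hT]; omega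
  · rw [a4]; simp [pA, l3]
  · intro z hz; rcases (l3 z).1 hz with h | h <;> simp [h, LT]
  · intro z hz; rcases (a3 z).1 hz with h | h <;> simp [h, AT]
  · intro z hz; simp [BT z hz]
  · intro z hz
    rcases (l3 z).1 hz with rfl | h
    · exact τT _ hp
    · exact τL _ h
  · intro z hz
    simp only [Finset.mem_insert, not_or] at hz
    exact τT _ hz.2
  · rw [a4, l4, mul_assoc, e, Equiv.mul_swap_eq_swap_mul, pA, mul_assoc]

lemma St.extB {n : ℕ} {M : Multiset ℕ} {r la lb : ℕ} (h : St n M r la lb) (hn : r + M.sum < n) :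
    St n M (r + 1) la (lb + 1) := by
  obtain ⟨T, L, A, B, τ, x, hT, hL, hA, hB, xA, xB, yL, LT, AT, BT, rfl, rfl, rfl, τL, τT, ct, e⟩ := h
  obtain ⟨p, hp⟩ := fresh T (by omega)
  obtain ⟨B', b1, b2, b3, b4⟩ := ins_left B hB x p xB (fun h => hp (BT _ h))
  obtain ⟨L', l1, l2, l3, l4⟩ := ins_left L hL _ p yL (fun h => hp (LT _ h))
  have pA : A.formPerm p = p := List.formPerm_apply_of_notMem (fun h => hp (AT _ h))
  refine ⟨insert p T, L', A, B', τ, x, ?_, l1, hA, b1, xA,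
    by simp [b3, xB], ?_, ?_, ?_, ?_, l2, rfl, b2, ?_, ?_, ct, ?_⟩
  · rw [Finset.card_insert_of_notMem hp, hT]; omega
  · simp [yL, l3]
  · intro z hz; rcases (l3 z).1 hz with h | h <;> simp [h, LT]
  · intro z hz; simp [AT z hz]
  · intro z hz; rcases (b3 z).1 hz with h | h <;> simp [h, BT]
  · intro z hz
    rcases (l3 z).1 hz with rfl | h
    · exact τT _ hp
    · exact τL _ h
  · intro z hz
    simp only [Finset.mem_insert, not_or] at hz
    exact τT _ hz.2
  · rw [b4, l4, mul_assoc, e, ← mul_assoc A.formPerm, Equiv.mul_swap_eq_swap_mul, pA, mul_assoc]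

lemma tri {α : Type*} [DecidableEq α] {x p q : α} (h1 : x ≠ p) (h2 : x ≠ q) (h3 : p ≠ q) :
    swap x p * swap x q * (swap x p * swap x q) = swap x q * swap x p := by
  ext z
  simp only [Perm.mul_apply, swap_apply_def]
  grind

lemma St.ext2 {n : ℕ} {M : Multiset ℕ} {r la lb : ℕ} (h : St n M r la lb)
    (hn : r + M.sum + 1 < n) : St n M (r + 2) (la + 2) (lb + 2) := by
  obtain ⟨T, L, A, B, τ, x, hT, hL, hA, hB, xA, xB, yL, LT, AT, BT, rfl, rfl, rfl, τL, τT, ct, e⟩ := h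
  obtain ⟨p, hp⟩ := fresh T (by omega)
  obtain ⟨q, hq'⟩ := fresh (insert p T) (by rw [Finset.card_insert_of_notMem hp]; omega)
  have hqp : q ≠ p := by rintro rfl; simp at hq'
  have hq : q ∉ T := by intro h; simp [h] at hq'
  have qA : A.formPerm q = q := List.formPerm_apply_of_notMem (fun h => hq (AT _ h))
  have pA : A.formPerm p = p := List.formPerm_apply_of_notMem (fun h => hp (AT _ h))
  obtain ⟨A', a1, a2, a3, a4⟩ := ins_right A hA x p xA (fun h => hp (AT _ h))
  obtain ⟨A2, c1, c2, c3, c4⟩ := ins_right A' a1 x q (by simp [a3, xA])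
    (by rw [a3]; rintro (h | h); exacts [hqp h, hq (AT _ h)])
  obtain ⟨B', b1, b2, b3, b4⟩ := ins_left B hB x q xB (fun h => hq (BT _ h))
  obtain ⟨B2, d1, d2, d3, d4⟩ := ins_left B' b1 x p (by simp [b3, xB])
    (by rw [b3]; rintro (h | h); exacts [hqp h.symm, hp (BT _ h)])
  obtain ⟨L', l1, l2, l3, l4⟩ := ins_left L hL _ p yL (fun h => hp (LT _ h))
  obtain ⟨L2, m1, m2, m3, m4⟩ := ins_left L' l1 (A.formPerm x) q (by simp [l3, yL])
    (by rw [l3]; rintro (h | h); exacts [hqp h, hq (LT _ h)])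
  have xp : x ≠ p := by rintro rfl; exact hp (AT _ xA)
  have xq : x ≠ q := by rintro rfl; exact hq (AT _ xA)
  refine ⟨insert q (insert p T), L2, A2, B2, τ, x, ?_, m1, c1, d1, by simp [c3, a3, xA],
    by simp [d3, b3, xB], ?_, ?_, ?_, ?_, by omega, by omega, by omega, ?_, ?_, ct, ?_⟩
  · rw [Finset.card_insert_of_notMem hq', Finset.card_insert_of_notMem hp, hT]; omega
  · rw [c4, a4]; simp [swap_apply_of_ne_of_ne xq.symm hqp, qA, m3]
  · intro z hz; rw [m3, l3] at hz; rcases hz with h | h | h <;> simp [h, LT]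
  · intro z hz; rw [c3, a3] at hz; rcases hz with h | h | h <;> simp [h, AT]
  · intro z hz; rw [d3, b3] at hz; rcases hz with h | h | h <;> simp [h, BT]
  · intro z hz
    rw [m3, l3] at hz
    rcases hz with rfl | rfl | h
    · exact τT _ hq
    · exact τT _ hp
    · exact τL _ h
  · intro z hz
    simp only [Finset.mem_insert, not_or] at hz
    exact τT _ hz.2.2
  · have t := tri xp xq hqp.symm
    calc L2.formPerm * τ = swap (A.formPerm x) q * (swap (A.formPerm x) p * (L.formPerm * τ)) := by
          rw [m4, l4]; simp only [mul_assoc]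
      _ = A.formPerm * (swap x q * swap x p) * B.formPerm := by
          have e1 : A.formPerm * swap x q = swap (A.formPerm x) q * A.formPerm := by
            rw [Equiv.mul_swap_eq_swap_mul, qA]
          have e2 : A.formPerm * swap x p = swap (A.formPerm x) p * A.formPerm := by
            rw [Equiv.mul_swap_eq_swap_mul, pA]
          rw [e, ← mul_assoc A.formPerm (swap x q), e1, mul_assoc (swap _ q) _ (swap x p), e2]
          simp only [mul_assoc]
      _ = _ := by
          rw [← t, c4, a4, d4, b4]; simp only [mul_assoc]

lemma St.ext_odd {n : ℕ} {M : Multiset ℕ} {a b : ℕ} (h : St n M 1 a b) (k g : ℕ) (hg : g ≤ k)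
    (hn : 1 + 2 * k + M.sum ≤ n) : St n M (1 + 2 * k) (a + k + g) (b + k + g) := by
  induction k generalizing g with
  | zero => simpa [Nat.le_zero.1 hg] using h
  | succ k ih =>
    rcases Nat.eq_zero_or_pos g with rfl | h0
    · have := ((ih 0 (by omega) (by omega)).extA (by omega)).extB (by omega)
      convert this using 1 <;> omega
    · obtain ⟨g, rfl⟩ : ∃ g', g = g' + 1 := ⟨g - 1, by omega⟩
      have := (ih g (by omega) (by omega)).ext2 (by omega)
      convert this using 1 <;> omega

def Reach (n : ℕ) (Ls : List ℕ) (la lb : ℕ) : Prop :=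
  (Ls = [] ∧ la = 0 ∧ lb = 0) ∨ ∃ r M, (Ls : Multiset ℕ) = r ::ₘ M ∧ St n M r la lb

lemma Reach.new {n : ℕ} {Ls : List ℕ} {la lb : ℕ} (h : Reach n Ls la lb) (hn : Ls.sum < n) :
    St n (Ls : Multiset ℕ) 1 (la + 1) (lb + 1) := by
  rcases h with ⟨rfl, rfl, rfl⟩ | ⟨r, M, h1, h2⟩
  · exact St.init (by omega)
  · rw [h1]
    apply h2.new
    have : (Ls : Multiset ℕ).sum = r + M.sum := by rw [h1]; simp
    rw [Multiset.sum_coe] at this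
    omega

def ev (Ls : List ℕ) : ℕ := (Ls.map (fun r => (r + 1) % 2)).sum

lemma ev_props (Ls : List ℕ) (h1 : ∀ r ∈ Ls, 1 ≤ r) :
    ev Ls % 2 = (Ls.sum + Ls.length) % 2 ∧ Ls.length + ev Ls ≤ Ls.sum := by
  induction Ls with
  | nil => simp [ev]
  | cons r Ls ih =>
    have := ih (fun x hx => h1 x (by simp [hx]))
    have h2 := h1 r (by simp)
    have h3 : ev (r :: Ls) = (r + 1) % 2 + ev Ls := by simp [ev]
    rw [h3, List.sum_cons, List.length_cons]
    omega

lemma pick_g (S c e t k D : ℕ) (h0 : e % 2 = (S + c) % 2) (h1 : c + e ≤ S)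
    (hp : t % 2 = (S + c + D) % 2) (lo : S + c + D + 2 * k ≤ t)
    (hi : t + e ≤ 2 * S + D + 4 * k) : ∃ g, g ≤ k ∧ S + c + D + 2 * k + 2 * g ≤ t ∧
      t + e ≤ 2 * S + D + 2 * k + 2 * g := by
  by_cases h : t + e ≤ 2 * S + D + 2 * k
  · exact ⟨0, by omega⟩
  · obtain ⟨g, hg⟩ : ∃ g, t + e = 2 * S + D + 2 * k + 2 * g :=
      ⟨(t + e - (2 * S + D + 2 * k)) / 2, by omega⟩
    exact ⟨g, by omega⟩

set_option maxHeartbeats 2000000 in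
lemma reach_all {n : ℕ} (Ls : List ℕ) (h1 : ∀ r ∈ Ls, 1 ≤ r) (hn : Ls.sum ≤ n) (la lb : ℕ)
    (hab : la ≤ lb + 1) (hba : lb ≤ la + 1) (hpar : (la + lb) % 2 = (Ls.sum + Ls.length) % 2)
    (hlo : Ls.sum + Ls.length ≤ la + lb) (hhi : la + lb + ev Ls ≤ 2 * Ls.sum) :
    Reach n Ls la lb := by
  induction Ls generalizing la lb with
  | nil => left; simp [ev] at *; omega
  | cons r Ls ih =>
    have hr := h1 r (by simp)
    have h1' : ∀ r ∈ Ls, 1 ≤ r := fun x hx => h1 x (by simp [hx])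
    have hp := ev_props Ls h1'
    have h3 : ev (r :: Ls) = (r + 1) % 2 + ev Ls := by simp [ev]
    rw [h3] at hhi
    simp only [List.sum_cons, List.length_cons] at *
    have ih := ih h1' (by omega)
    right
    refine ⟨r, Ls, rfl, ?_⟩
    have key : ∀ k g d d', r = 1 + 2 * k + d + d' → (d, d') = (0,0) ∨ (d, d') = (1,0) ∨ (d,d') = (0,1) →
      g ≤ k → 1 + k + g + d ≤ la → 1 + k + g + d' ≤ lb →
      Reach n Ls (la - (1 + k + g + d)) (lb - (1 + k + g + d')) → St n Ls r la lb := by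
      intro k g d d' e hd hg ha hb H
      have := (H.new (by omega)).ext_odd k g hg (by simp; omega)
      simp only [Prod.mk.injEq] at hd
      rcases hd with ⟨rfl, rfl⟩ | ⟨rfl, rfl⟩ | ⟨rfl, rfl⟩
      · convert this using 1 <;> omega
      · have := this.extA (by simp; omega)
        convert this using 1 <;> omega
      · have := this.extB (by simp; omega)
        convert this using 1 <;> omega
    obtain ⟨k, hk | hk⟩ : ∃ k, r = 1 + 2 * k ∨ r = 2 + 2 * k := ⟨(r - 1) / 2, by omega⟩
    · obtain ⟨g, hg, g1, g2⟩ : ∃ g, g ≤ k ∧ Ls.sum + Ls.length + 2 + 2 * k + 2 * g ≤ la + lb ∧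
          la + lb + ev Ls ≤ 2 * Ls.sum + 2 + 2 * k + 2 * g :=
        pick_g _ _ _ _ k 2 hp.1 hp.2 (by omega) (by omega) (by omega)
      exact key k g 0 0 (by omega) (by simp) hg (by omega) (by omega)
        (ih _ _ (by omega) (by omega) (by omega) (by omega) (by omega))
    · obtain ⟨g, hg, g1, g2⟩ : ∃ g, g ≤ k ∧ Ls.sum + Ls.length + 3 + 2 * k + 2 * g ≤ la + lb ∧
          la + lb + ev Ls ≤ 2 * Ls.sum + 3 + 2 * k + 2 * g :=
        pick_g _ _ _ _ k 3 hp.1 hp.2 (by omega) (by omega) (by omega)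
      by_cases hc : lb ≤ la
      · exact key k g 1 0 (by omega) (by simp) hg (by omega) (by omega)
          (ih _ _ (by omega) (by omega) (by omega) (by omega) (by omega))
      · exact key k g 0 1 (by omega) (by simp) hg (by omega) (by omega)
          (ih _ _ (by omega) (by omega) (by omega) (by omega) (by omega))

lemma IsProdOfCycles.conj {n k l : ℕ} {σ : Perm (Fin n)} (h : IsProdOfCycles n k l σ)
    (g : Perm (Fin n)) : IsProdOfCycles n k l (g * σ * g⁻¹) := by
  obtain ⟨c, hc, rfl⟩ := h
  refine ⟨fun i => g * c i * g⁻¹, fun i => ⟨(hc i).1.conj, ?_⟩, ?_⟩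
  · rw [Perm.card_support_conj, (hc i).2]
  · have : (fun i => g * c i * g⁻¹) = (MulAut.conj g) ∘ c := by ext; simp
    rw [this, ← List.map_ofFn, ← map_list_prod]
    simp

lemma IsProdOfCycles.of_ct {n k l : ℕ} {σ τ : Perm (Fin n)} (h : IsProdOfCycles n k l σ)
    (e : σ.cycleType = τ.cycleType) : IsProdOfCycles n k l τ := by
  obtain ⟨g, rfl⟩ := isConj_iff.1 (Perm.isConj_iff_cycleType_eq.2 e)
  exact h.conj g

lemma IsProdOfCycles.mul {n k k' l : ℕ} {σ τ : Perm (Fin n)} (h : IsProdOfCycles n k l σ)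
    (h' : IsProdOfCycles n k' l τ) : IsProdOfCycles n (k + k') l (σ * τ) := by
  obtain ⟨c, hc, rfl⟩ := h
  obtain ⟨d, hd, rfl⟩ := h'
  refine ⟨Fin.append c d, ?_, ?_⟩
  · intro i
    refine Fin.addCases (fun i => ?_) (fun i => ?_) i
    · simpa using hc i
    · simpa using hd i
  · rw [List.ofFn_fin_append, List.prod_append]

lemma isCyc {n : ℕ} (L : List (Fin n)) (hL : L.Nodup) (h : 2 ≤ L.length) :
    L.formPerm.IsCycle ∧ L.formPerm.support.card = L.length := by
  refine ⟨List.isCycle_formPerm hL h, ?_⟩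
  rw [List.support_formPerm_of_nodup _ hL, List.toFinset_card_of_nodup hL]
  rintro x rfl
  simp at h

lemma two_cycles_list {n l : ℕ} (hl : 2 ≤ l) (Ls : List ℕ) (h1 : ∀ r ∈ Ls, 1 ≤ r)
    (hn : Ls.sum ≤ n) (hpar : (Ls.sum + Ls.length) % 2 = 0)
    (hlo : Ls.sum + Ls.length ≤ 2 * l) (hhi : 2 * l + ev Ls ≤ 2 * Ls.sum) (σ : Perm (Fin n))
    (hσ : σ.cycleType = (Ls : Multiset ℕ).filter (2 ≤ ·)) : IsProdOfCycles n 2 l σ := by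
  rcases reach_all (n := n) Ls h1 hn l l (by omega) (by omega) (by omega) (by omega) (by omega)
    with h | ⟨r, M, e, T, L, A, B, τ, x, hT, hL, hA, hB, xA, xB, yL, LT, AT, BT, rL, lA, lB, τL, τT, ct, eq⟩
  · omega
  · have : IsProdOfCycles n 2 l (A.formPerm * B.formPerm) := by
      refine ⟨![A.formPerm, B.formPerm], ?_, by simp⟩
      rw [Fin.forall_fin_two]
      constructor
      · simpa [lA] using isCyc A hA (by omega)
      · simpa [lB] using isCyc B hB (by omega)
    refine this.of_ct ?_
    rw [← eq, (disj_fp L τ τL).cycleType_mul, ct, ct_formPerm L hL, hσ, e, rL,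
      ← Multiset.singleton_add, Multiset.filter_add]

lemma even_iff {n : ℕ} (σ : Perm (Fin n)) : σ ∈ alternatingGroup (Fin n) ↔
    (σ.cycleType.sum + σ.cycleType.card) % 2 = 0 := by
  rw [Perm.mem_alternatingGroup, Perm.sign_of_cycleType, ← Nat.even_iff]
  constructor
  · intro h
    by_contra hc
    rw [Nat.not_even_iff_odd] at hc
    rw [hc.neg_one_pow] at h
    exact absurd h (by decide)
  · intro h; exact h.neg_one_pow

lemma ev_append (a b : List ℕ) : ev (a ++ b) = ev a + ev b := by simp [ev]

lemma half_bound (Ls : List ℕ) (h : ∀ r ∈ Ls, 2 ≤ r) : 2 * Ls.length ≤ Ls.sum ∧ 2 * ev Ls ≤ Ls.sum := by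
  induction Ls with
  | nil => simp [ev]
  | cons r Ls ih =>
    have := ih (fun x hx => h x (by simp [hx]))
    have h2 := h r (by simp)
    have h3 : ev (r :: Ls) = (r + 1) % 2 + ev Ls := by simp [ev]
    rw [h3, List.sum_cons, List.length_cons]
    omega

/-- weight at most `2l`, with enough room -/
lemma two_cycles {n l : ℕ} (hl : 2 ≤ l) (σ : Perm (Fin n)) (hσ : σ ∈ alternatingGroup (Fin n))
    (hw : σ.cycleType.sum + σ.cycleType.card ≤ 2 * l) (hn : 4 * l ≤ 3 * n) :
    IsProdOfCycles n 2 l σ := by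
  rw [even_iff] at hσ
  obtain ⟨Ls, hLs⟩ := Quot.exists_rep σ.cycleType
  replace hLs : (Ls : Multiset ℕ) = σ.cycleType := hLs
  have h2 : ∀ r ∈ Ls, 2 ≤ r := by
    intro r hr
    exact Perm.two_le_of_mem_cycleType (by rw [← hLs]; exact hr)
  have hsum : σ.cycleType.sum ≤ n := by
    rw [Perm.sum_cycleType]; simpa using Finset.card_le_univ σ.support
  rw [← hLs] at hσ hw hsum
  simp only [Multiset.sum_coe, Multiset.coe_card] at hσ hw hsum
  have hb := half_bound Ls h2
  have hp := ev_props Ls (fun r hr => (by have := h2 r hr; omega))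
  set g := l + ev Ls / 2 - Ls.sum with hg
  have e1 : ev (List.replicate g 1) = 0 := by simp [ev]
  refine two_cycles_list hl (Ls ++ List.replicate g 1) ?_ ?_ ?_ ?_ ?_ σ ?_
  · intro r hr
    rw [List.mem_append] at hr
    rcases hr with hr | hr
    · have := h2 r hr; omega
    · rw [(List.mem_replicate.1 hr).2]
  · simp; omega
  · simp; omega
  · simp; omega
  · rw [ev_append, e1]; simp; omega
  · rw [← hLs, ← Multiset.coe_add, Multiset.filter_add, Multiset.filter_eq_self.2 (by simpa using h2),
      Multiset.filter_eq_nil.2]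
    · simp
    · intro a ha
      rw [Multiset.mem_coe] at ha
      simp [(List.mem_replicate.1 ha).2]

lemma realize {n : ℕ} (Ls : List ℕ) (U : Finset (Fin n)) (h : Ls.sum ≤ U.card) :
    ∃ τ : Perm (Fin n), (∀ z, z ∉ U → τ z = z) ∧
      τ.cycleType = (Ls : Multiset ℕ).filter (2 ≤ ·) := by
  induction Ls generalizing U with
  | nil => exact ⟨1, by simp, by simp⟩
  | cons r Ls ih =>
    simp only [List.sum_cons] at h
    obtain ⟨V, hV, hr⟩ := Finset.exists_subset_card_eq (s := U) (n := r) (by omega)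
    obtain ⟨τ, h1, h2⟩ := ih (U \ V) (by rw [Finset.card_sdiff_of_subset hV]; omega)
    have hd : Perm.Disjoint V.toList.formPerm τ := disj_fp _ _ (by
      intro z hz; rw [Finset.mem_toList] at hz; exact h1 z (by simp [hz]))
    refine ⟨V.toList.formPerm * τ, ?_, ?_⟩
    · intro z hz
      have : z ∉ V.toList := by rw [Finset.mem_toList]; exact fun h => hz (hV h)
      simp [h1 z (by simp [hz]), List.formPerm_apply_of_notMem this]
    · rw [hd.cycleType_mul, h2, ct_formPerm _ (Finset.nodup_toList V), Finset.length_toList, hr,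
        ← Multiset.filter_add, Multiset.singleton_add, Multiset.cons_coe]

lemma formPerm_split {α : Type*} [DecidableEq α] (L1 L2 : List α) (x : α) :
    (L1 ++ x :: L2).formPerm = (L1 ++ [x]).formPerm * (x :: L2).formPerm := by
  induction L1 with
  | nil => simp
  | cons a L1 ih =>
    cases L1 with
    | nil => simp
    | cons b L1 =>
      simp only [List.cons_append, List.formPerm_cons_cons, mul_assoc] at *
      rw [ih]

lemma split_real {n : ℕ} (r s : ℕ) (I J : List ℕ) (hs : 1 ≤ s) (hr : s ≤ r)
    (hn : r + I.sum + J.sum ≤ n) : ∃ α β : Perm (Fin n),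
      (α * β).cycleType = ((r :: (I ++ J) : List ℕ) : Multiset ℕ).filter (2 ≤ ·) ∧
      α.cycleType = ((s :: I : List ℕ) : Multiset ℕ).filter (2 ≤ ·) ∧
      β.cycleType = (((r + 1 - s) :: J : List ℕ) : Multiset ℕ).filter (2 ≤ ·) := by
  obtain ⟨V, -, hV⟩ := Finset.exists_subset_card_eq (s := (Finset.univ : Finset (Fin n))) (n := r)
    (by simp; omega)
  have hc : (Vᶜ).card = n - r := by rw [Finset.card_compl, hV]; simp
  obtain ⟨U, hU, hUc⟩ := Finset.exists_subset_card_eq (s := Vᶜ) (n := I.sum) (by omega)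
  obtain ⟨τ, t1, t2⟩ := realize I U (by omega)
  obtain ⟨ρ, r1, r2⟩ := realize J (Vᶜ \ U) (by rw [Finset.card_sdiff_of_subset hU]; omega)
  have nd := Finset.nodup_toList V
  have len : V.toList.length = r := by simp [hV]
  obtain ⟨L1, x, L2, hL, l1⟩ : ∃ L1 x L2, V.toList = L1 ++ x :: L2 ∧ L1.length = s - 1 := by
    refine ⟨V.toList.take (s-1), V.toList[s-1]'(by omega), V.toList.drop (s - 1 + 1), ?_, ?_⟩
    · rw [← List.drop_eq_getElem_cons, List.take_append_drop]
    · simp; omega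
  have mV : ∀ z, z ∈ L1 ++ x :: L2 → z ∈ V := by
    intro z hz; rw [← hL, Finset.mem_toList] at hz; exact hz
  rw [hL] at nd len
  have tV : ∀ z ∈ V, τ z = z := fun z hz => t1 z (fun h => by simpa [hz] using hU h)
  have rV : ∀ z ∈ V, ρ z = z := fun z hz => r1 z (by simp [hz])
  have nd1 : (L1 ++ [x]).Nodup := nd.sublist (by simp)
  have nd2 : (x :: L2).Nodup := nd.sublist (by simp)
  have d1 : Perm.Disjoint (L1 ++ [x]).formPerm τ := disj_fp _ _ (fun z hz => tV z (mV z (by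
    simp at hz ⊢; tauto)))
  have d2 : Perm.Disjoint (x :: L2).formPerm ρ := disj_fp _ _ (fun z hz => rV z (mV z (by
    simp at hz ⊢; tauto)))
  have d3 : Perm.Disjoint (x :: L2).formPerm τ := disj_fp _ _ (fun z hz => tV z (mV z (by
    simp at hz ⊢; tauto)))
  have d4 : Perm.Disjoint τ ρ := by
    intro z
    by_cases hz : z ∈ U
    · exact Or.inr (r1 z (by simp [hz]))
    · exact Or.inl (t1 z hz)
  have d5 : Perm.Disjoint (L1 ++ x :: L2).formPerm (τ * ρ) := disj_fp _ _ (fun z hz => by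
    simp [rV z (mV z hz), tV z (mV z hz)])
  refine ⟨(L1 ++ [x]).formPerm * τ, (x :: L2).formPerm * ρ, ?_, ?_, ?_⟩
  · have : (L1 ++ [x]).formPerm * τ * ((x :: L2).formPerm * ρ) = (L1 ++ x :: L2).formPerm * (τ * ρ) := by
      rw [formPerm_split L1 L2 x, mul_assoc, ← mul_assoc τ, ← d3.commute.eq]
      simp only [mul_assoc]
    rw [this, d5.cycleType_mul, d4.cycleType_mul, t2, r2, ct_formPerm _ nd, len,
      ← Multiset.filter_add, ← Multiset.filter_add, Multiset.singleton_add, Multiset.coe_add,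
      Multiset.cons_coe]
  · rw [d1.cycleType_mul, t2, ct_formPerm _ nd1, ← Multiset.filter_add, Multiset.singleton_add,
      Multiset.cons_coe]
    congr 3
    simp; omega
  · rw [d2.cycleType_mul, r2, ct_formPerm _ nd2, ← Multiset.filter_add, Multiset.singleton_add,
      Multiset.cons_coe]
    congr 3
    simp at len ⊢; omega

lemma prefix_cut (Ls : List ℕ) (T : ℕ) (hT : 1 ≤ T) (h : T ≤ Ls.sum) :
    ∃ I r J, Ls = I ++ r :: J ∧ I.sum < T ∧ T ≤ I.sum + r := by
  induction Ls generalizing T with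
  | nil => simp at h; omega
  | cons a Ls ih =>
    simp only [List.sum_cons] at h
    by_cases ha : T ≤ a
    · exact ⟨[], a, Ls, by simp, by simp; omega, by simpa using ha⟩
    · obtain ⟨I, r, J, h1, h2, h3⟩ := ih (T - a) (by omega) (by omega)
      exact ⟨a :: I, r, J, by simp [h1], by simp; omega, by simp; omega⟩

lemma sum_lb (I : List ℕ) (r : ℕ) (h : ∀ a ∈ I, r ≤ a) : I.length * r ≤ I.sum := by
  induction I with
  | nil => simp
  | cons a I ih =>
    have := ih (fun x hx => h x (by simp [hx]))
    have := h a (by simp)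
    simp [add_mul]; omega

lemma sum_ub (I : List ℕ) (r : ℕ) (h : ∀ a ∈ I, a ≤ r) : I.sum ≤ I.length * r := by
  induction I with
  | nil => simp
  | cons a I ih =>
    have := ih (fun x hx => h x (by simp [hx]))
    have := h a (by simp)
    simp [add_mul]; omega

lemma two_ones (J : List ℕ) (h1 : ∀ a ∈ J, 1 ≤ a) (h2 : ∀ a ∈ J, a ≤ 2)
    (h : J.sum + 2 ≤ 2 * J.length) : ∃ J', J.Perm (1 :: 1 :: J') := by
  have hc : J.sum + J.count 1 = 2 * J.length := by
    clear h
    induction J with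
    | nil => simp
    | cons a J ih =>
      have := ih (fun x hx => h1 x (by simp [hx])) (fun x hx => h2 x (by simp [hx]))
      have a1 := h1 a (by simp)
      have a2 := h2 a (by simp)
      rcases (by omega : a = 1 ∨ a = 2) with rfl | rfl
      · simp; omega
      · simp; omega
  have : List.Sublist (List.replicate 2 1) J := List.replicate_sublist_iff.2 (by omega)
  obtain ⟨J', hJ⟩ := this.exists_perm_append
  exact ⟨J', hJ⟩

lemma step_comb (m q : ℕ) (hm : 2 ≤ m) (hq : 1 ≤ q) (Ls : List ℕ)
    (hsort : Ls.Pairwise (· ≥ ·)) (hpos : ∀ a ∈ Ls, 1 ≤ a) (hsum : Ls.sum = 4 * q + 4 * m + 1)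
    (hlen : Ls.length % 2 = 1) : ∃ r s I J, 1 ≤ s ∧ s ≤ r ∧ Ls.Perm (r :: (I ++ J)) ∧
      ((I.sum + s = 4 * m + 1 ∧ I.length % 2 = 0) ∨
       (I.sum + s = 4 * m + 2 ∧ I.length % 2 = 1 ∧ I.length + 3 ≤ 2 * m)) := by
  obtain ⟨I, r, J, rfl, h2, h3⟩ := prefix_cut Ls (4 * m + 1) (by omega) (by omega)
  simp only [List.sum_append, List.sum_cons, List.length_append, List.length_cons] at hsum hlen
  rw [List.pairwise_append, List.pairwise_cons] at hsort
  obtain ⟨-, ⟨hJ, -⟩, hIJ⟩ := hsort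
  have pm : (I ++ r :: J).Perm (r :: (I ++ J)) := List.perm_middle
  rcases Nat.mod_two_eq_zero_or_one I.length with ho | ho
  · exact ⟨r, 4 * m + 1 - I.sum, I, J, by omega, by omega, pm, Or.inl (by omega)⟩
  by_cases hr : I.sum + r = 4 * m + 1
  · by_cases hex : ∃ a ∈ I ++ [r], ∃ b ∈ J, a ≠ b
    · obtain ⟨a, ha, b, hb, hab⟩ := hex
      have hge : b ≤ a := by
        rw [List.mem_append, List.mem_singleton] at ha
        rcases ha with ha | rfl
        · exact hIJ a ha b (by simp [hb])
        · exact hJ b hb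
      have hb1 := hpos b (by simp [hb])
      have pK := List.perm_cons_erase ha
      have pJ := List.perm_cons_erase hb
      have sK := pK.sum_eq
      have lK := pK.length_eq
      simp only [List.sum_append, List.sum_cons, List.length_append, List.length_cons, List.sum_nil,
        List.length_nil] at sK lK
      refine ⟨a, a - b, b :: (I ++ [r]).erase a, J.erase b, by omega, by omega, ?_, Or.inl ?_⟩
      · have : (I ++ r :: J) = (I ++ [r]) ++ J := by simp
        rw [this]
        refine (pK.append pJ).trans ?_
        simp only [List.cons_append]
        exact List.Perm.cons _ List.perm_middle
      · simp only [List.sum_cons, List.length_cons]; omega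
    · exfalso
      push Not at hex
      cases J with
      | nil => simp at hsum; omega
      | cons b J =>
        have hall : ∀ a ∈ I ++ [r], a = b := fun a ha => hex a ha b (by simp)
        have u1 := sum_lb (I ++ [r]) b (fun a ha => (hall a ha).ge)
        have u2 := sum_ub (I ++ [r]) b (fun a ha => (hall a ha).le)
        have u3 : (I ++ [r]).sum = (I ++ [r]).length * b := le_antisymm u2 u1
        simp only [List.sum_append, List.length_append, List.sum_cons, List.sum_nil,
          List.length_cons, List.length_nil] at u3
        have : (I.length + (0 + 1)) % 2 = 0 := by omega
        have : ((I.length + (0 + 1)) * b) % 2 = 0 := by rw [Nat.mul_mod, this]; simp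
        omega
  · by_cases hw : I.length + 3 ≤ 2 * m
    · exact ⟨r, 4 * m + 2 - I.sum, I, J, by omega, by omega, pm, Or.inr (by omega)⟩
    have hIr := sum_lb I r (fun a ha => hIJ a ha r (by simp))
    have hr3 : r = 2 := by
      by_contra hne
      have : 3 ≤ r := by omega
      have := Nat.mul_le_mul_left I.length this
      omega
    subst hr3
    have hIs : I.sum = 4 * m := by omega
    have hIl : I.length = 2 * m - 1 := by omega
    obtain ⟨t, ht, ht3⟩ : ∃ t ∈ I, 3 ≤ t := by
      by_contra! hc
      have := sum_ub I 2 (fun a ha => by have := hc a ha; omega)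
      omega
    obtain ⟨J', pJ⟩ := two_ones J (fun a ha => hpos a (by simp [ha])) hJ (by
      have := sum_ub J 2 hJ
      omega)
    have pI := List.perm_cons_erase ht
    have sI := pI.sum_eq
    have lI := pI.length_eq
    simp only [List.sum_cons, List.length_cons] at sI lI
    refine ⟨t, t - 1, 1 :: 1 :: I.erase t, 2 :: J', by omega, by omega, ?_, Or.inl ?_⟩
    · refine (pI.append (pJ.cons 2)).trans ?_
      simp only [List.cons_append]
      refine List.Perm.cons _ ?_
      rw [← Multiset.coe_eq_coe]
      simp only [← Multiset.coe_add, ← Multiset.cons_coe, Multiset.add_cons]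
      rw [Multiset.cons_swap 2 1, Multiset.cons_swap 2 1]
    · simp only [List.sum_cons, List.length_cons]; omega

lemma filt_props (Ls : List ℕ) (hpos : ∀ a ∈ Ls, 1 ≤ a) :
    ∃ g, ((Ls : Multiset ℕ).filter (2 ≤ ·)).sum + g = Ls.sum ∧
      ((Ls : Multiset ℕ).filter (2 ≤ ·)).card + g = Ls.length ∧
      2 * ((Ls : Multiset ℕ).filter (2 ≤ ·)).card ≤ ((Ls : Multiset ℕ).filter (2 ≤ ·)).sum := by
  induction Ls with
  | nil => exact ⟨0, by simp⟩
  | cons a Ls ih =>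
    obtain ⟨g, h1, h2, h3⟩ := ih (fun x hx => hpos x (by simp [hx]))
    have ha := hpos a (by simp)
    rw [← Multiset.cons_coe]
    by_cases h : 2 ≤ a
    · have e : Multiset.filter (fun x => 2 ≤ x) (a ::ₘ (Ls : Multiset ℕ)) =
          a ::ₘ Multiset.filter (fun x => 2 ≤ x) Ls := Multiset.filter_cons_of_pos _ h
      rw [e]
      refine ⟨g, ?_⟩
      simp only [Multiset.sum_cons, Multiset.card_cons, List.sum_cons, List.length_cons]
      omega
    · have e : Multiset.filter (fun x => 2 ≤ x) (a ::ₘ (Ls : Multiset ℕ)) =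
          Multiset.filter (fun x => 2 ≤ x) Ls := Multiset.filter_cons_of_neg _ h
      rw [e]
      refine ⟨g + 1, ?_⟩
      simp only [List.sum_cons, List.length_cons]
      omega

lemma lower {m : ℕ} (hm : 2 ≤ m) (j : ℕ) (hj : 1 ≤ j) : ∀ (n : ℕ), 4 * (j * m) + 1 ≤ n →
    ∀ σ ∈ alternatingGroup (Fin n), σ.cycleType.sum ≤ 4 * (j * m) + 1 →
    IsProdOfCycles n (2 * j) (3 * m) σ := by
  induction j, hj using Nat.le_induction with
  | base =>
    intro n hn σ hσ hs
    have h := (even_iff σ).1 hσ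
    have hc : 2 * σ.cycleType.card ≤ σ.cycleType.sum := by
      have := Multiset.card_nsmul_le_sum (s := σ.cycleType) (a := 2)
        (fun x hx => Perm.two_le_of_mem_cycleType hx)
      simp at this ⊢; omega
    exact two_cycles (by omega) σ hσ (by omega) (by omega)
  | succ j hj ih =>
    intro n hn σ hσ hs
    have h := (even_iff σ).1 hσ
    have hq : 1 ≤ j * m := Nat.mul_pos hj (by omega)
    rw [add_mul, one_mul] at hn hs
    generalize hqq : j * m = q at *
    set g := 4 * q + 4 * m + 1 - σ.cycleType.sum with hg
    set W : Multiset ℕ := σ.cycleType + Multiset.replicate g 1 with hW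
    have hWf : W.filter (2 ≤ ·) = σ.cycleType := by
      rw [hW, Multiset.filter_add, Multiset.filter_eq_self.2
        (fun x hx => Perm.two_le_of_mem_cycleType hx), Multiset.filter_eq_nil.2, add_zero]
      intro a ha
      simp [Multiset.eq_of_mem_replicate ha]
    have hWs : W.sum = 4 * q + 4 * m + 1 := by rw [hW]; simp; omega
    have hWc : W.card = σ.cycleType.card + g := by rw [hW]; simp
    have hWp : ∀ a ∈ W, 1 ≤ a := by
      intro a ha
      rw [hW, Multiset.mem_add] at ha
      rcases ha with ha | ha
      · have := Perm.two_le_of_mem_cycleType ha; omega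
      · simp [Multiset.eq_of_mem_replicate ha]
    have hsc : ((W.sort (· ≥ ·) : List ℕ) : Multiset ℕ) = W := Multiset.sort_eq _ _
    obtain ⟨r, s, I, J, s1, sr, pm, hcase⟩ := step_comb m q hm hq (W.sort (· ≥ ·))
      (Multiset.pairwise_sort _ _) (fun a ha => hWp a (by rwa [Multiset.mem_sort] at ha))
      (by rw [← Multiset.sum_coe, hsc, hWs]) (by rw [← Multiset.coe_card, hsc]; omega)
    have hWe : W = ((r :: (I ++ J) : List ℕ) : Multiset ℕ) := by
      rw [← hsc]; exact Multiset.coe_eq_coe.2 pm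
    have hSum : r + (I.sum + J.sum) = 4 * q + 4 * m + 1 := by
      rw [← hWs, hWe]; simp
    have hposI : ∀ a ∈ s :: I, 1 ≤ a := by
      intro a ha
      rw [List.mem_cons] at ha
      rcases ha with rfl | ha
      · exact s1
      · exact hWp a (by rw [hWe]; simp [ha])
    have hposJ : ∀ a ∈ (r + 1 - s) :: J, 1 ≤ a := by
      intro a ha
      rw [List.mem_cons] at ha
      rcases ha with rfl | ha
      · omega
      · exact hWp a (by rw [hWe]; simp [ha])
    obtain ⟨α, β, e1, e2, e3⟩ := split_real (n := n) r s I J s1 sr (by omega)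
    obtain ⟨g1, a1, a2, a3⟩ := filt_props _ hposI
    obtain ⟨g2, b1, b2, b3⟩ := filt_props _ hposJ
    rw [← e2] at a1 a2 a3
    rw [← e3] at b1 b2 b3
    simp only [List.sum_cons, List.length_cons] at a1 a2 b1 b2
    have e4 : (α * β).cycleType = σ.cycleType := by rw [e1, ← hWe, hWf]
    have hα : α ∈ alternatingGroup (Fin n) := by rw [even_iff]; omega
    have hβ : β ∈ alternatingGroup (Fin n) := by
      have : α * β ∈ alternatingGroup (Fin n) := by rw [even_iff, e4]; exact h
      exact (Subgroup.mul_mem_cancel_left _ hα).1 this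
    have P1 : IsProdOfCycles n 2 (3 * m) α := two_cycles (by omega) α hα (by omega) (by omega)
    have P2 := ih n (by omega) β hβ (by omega)
    have := (P1.mul P2).of_ct e4
    convert this using 1
    ring

def mv {n : ℕ} (cs : List (Perm (Fin n))) (x : Fin n) : ℕ := cs.countP (fun c => decide (c x ≠ x))

lemma mv_cons {n : ℕ} (c : Perm (Fin n)) (cs : List (Perm (Fin n))) (x : Fin n) :
    mv (c :: cs) x = mv cs x + if c x ≠ x then 1 else 0 := by
  simp [mv, List.countP_cons]

lemma mv_zero {n : ℕ} (cs : List (Perm (Fin n))) (x : Fin n) (h : mv cs x = 0) :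
    cs.prod x = x := by
  induction cs with
  | nil => simp
  | cons c cs ih =>
    rw [mv_cons] at h
    have h1 : c x = x := by by_contra hc; simp [hc] at h
    rw [List.prod_cons, Perm.mul_apply, ih (by omega), h1]

lemma mv_pair {n : ℕ} (cs : List (Perm (Fin n))) (x y : Fin n) (hxy : x ≠ y)
    (hc : ∀ c ∈ cs, ¬ (c x = y ∧ c y = x)) (h1 : cs.prod x = y) (h2 : cs.prod y = x) :
    3 ≤ mv cs x + mv cs y := by
  induction cs with
  | nil => exact absurd h1 (by simpa using hxy)
  | cons c cs ih =>
    have zx : mv (c :: cs) x ≠ 0 := fun h => hxy ((mv_zero _ x h).symm.trans h1)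
    have zy : mv (c :: cs) y ≠ 0 := fun h => hxy (h2.symm.trans (mv_zero _ y h))
    have nc := hc c (by simp)
    rw [List.prod_cons, Perm.mul_apply] at h1 h2
    rw [mv_cons] at zx zy ⊢
    rw [mv_cons]
    by_cases cx : c x = x <;> by_cases cy : c y = y
    · have := ih (fun d hd => hc d (by simp [hd])) (c.injective (h1.trans cy.symm))
        (c.injective (h2.trans cx.symm))
      omega
    · have : mv cs y ≠ 0 := by
        intro h0
        rw [mv_zero _ _ h0] at h2
        exact hxy (c.injective (cx.trans h2.symm))
      simp [cx, cy] at zx zy ⊢; omega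
    · have : mv cs x ≠ 0 := by
        intro h0
        rw [mv_zero _ _ h0] at h1
        exact hxy (c.injective (h1.trans cy.symm))
      simp [cx, cy] at zx zy ⊢; omega
    · have : mv cs x ≠ 0 ∨ mv cs y ≠ 0 := by
        by_contra! h0
        rw [mv_zero _ _ h0.1] at h1
        rw [mv_zero _ _ h0.2] at h2
        exact nc ⟨h1, h2⟩
      simp [cx, cy]; omega

lemma mv_sum {n l : ℕ} (cs : List (Perm (Fin n))) (h : ∀ c ∈ cs, c.support.card = l) :
    ∑ x, mv cs x = cs.length * l := by
  induction cs with
  | nil => simp [mv]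
  | cons c cs ih =>
    have h1 : c.support.card = ∑ x, if c x ≠ x then 1 else 0 := by
      rw [Finset.sum_boole]; rfl
    simp only [mv_cons, Finset.sum_add_distrib]
    rw [← h1, ih (fun d hd => h d (by simp [hd])), h c (by simp), List.length_cons]
    ring

lemma upper_ineq {n k l : ℕ} (hl : 3 ≤ l) (σ : Perm (Fin n)) (h : IsProdOfCycles n k l σ)
    (S : Finset (Fin n)) (hf : ∀ x, σ x ≠ x) (hS : ∀ x, x ∉ S → σ (σ x) = x) :
    3 * n ≤ 2 * (k * l) + S.card := by
  obtain ⟨c, hc, e⟩ := h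
  set cs := List.ofFn c with hcs
  have hmem : ∀ d ∈ cs, d.IsCycle ∧ d.support.card = l := by
    intro d hd
    rw [hcs, List.mem_ofFn] at hd
    obtain ⟨i, rfl⟩ := hd
    exact hc i
  have hsum := mv_sum cs (fun d hd => (hmem d hd).2)
  have hlen : cs.length = k := by simp [hcs]
  have hnc : ∀ x y, x ≠ y → ∀ d ∈ cs, ¬ (d x = y ∧ d y = x) := by
    rintro x y hxy d hd ⟨h1, h2⟩
    have h3 : d ^ 2 = 1 := (hmem d hd).1.pow_eq_one_iff.2
      ⟨x, by rw [h1]; exact hxy.symm, by rw [pow_two, Perm.mul_apply, h1, h2]⟩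
    have h4 := orderOf_dvd_of_pow_eq_one h3
    rw [(hmem d hd).1.orderOf, (hmem d hd).2] at h4
    have := Nat.le_of_dvd (by norm_num) h4
    omega
  have key : ∀ x, 3 ≤ mv cs x + mv cs (σ x) + if x ∈ S then 1 else 0 := by
    intro x
    by_cases hx : x ∈ S
    · have z : ∀ y, mv cs y ≠ 0 := fun y h0 => hf y (by rw [e]; exact mv_zero _ _ h0)
      have := z x
      have := z (σ x)
      rw [if_pos hx]; omega
    · have := mv_pair cs x (σ x) (hf x).symm (hnc _ _ (hf x).symm) (by rw [e])
        (by rw [← e]; exact hS x hx)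
      omega
  have h1 : ∑ x : Fin n, 3 ≤ ∑ x, (mv cs x + mv cs (σ x) + if x ∈ S then 1 else 0) :=
    Finset.sum_le_sum (fun x _ => key x)
  rw [Finset.sum_add_distrib, Finset.sum_add_distrib, Equiv.sum_comp σ (mv cs), hsum,
    Finset.sum_boole] at h1
  simp [hlen] at h1
  omega

lemma bad_perm (n r p : ℕ) (hn : n = r + 2 * p) (hr : r ≠ 1)
    (hpar : (n + p + if 2 ≤ r then 1 else 0) % 2 = 0) :
    ∃ σ ∈ alternatingGroup (Fin n), (∀ x, σ x ≠ x) ∧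
      ∃ S : Finset (Fin n), S.card = r ∧ ∀ x, x ∉ S → σ (σ x) = x := by
  obtain ⟨V, -, hV⟩ := Finset.exists_subset_card_eq (s := (Finset.univ : Finset (Fin n))) (n := r)
    (by simp; omega)
  have hc : (Vᶜ).card = n - r := by rw [Finset.card_compl, hV]; simp
  obtain ⟨τ, t1, t2⟩ := realize (List.replicate p 2) Vᶜ (by simp; omega)
  have t3 : τ.cycleType = Multiset.replicate p 2 := by
    rw [t2, Multiset.filter_eq_self.2]
    · exact Multiset.coe_replicate p 2
    · intro a ha; rw [Multiset.mem_coe] at ha; simp [(List.mem_replicate.1 ha).2]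
  have d : Perm.Disjoint V.toList.formPerm τ := disj_fp _ _ (by
    intro z hz; rw [Finset.mem_toList] at hz; exact t1 z (by simp [hz]))
  have ct : (V.toList.formPerm * τ).cycleType =
      Multiset.filter (2 ≤ ·) {r} + Multiset.replicate p 2 := by
    rw [d.cycleType_mul, t3, ct_formPerm _ (Finset.nodup_toList V), Finset.length_toList, hV]
  have hτ : τ ^ 2 = 1 := by
    rw [← orderOf_dvd_iff_pow_eq_one, ← Perm.lcm_cycleType, t3, Multiset.lcm_dvd]
    intro b hb
    rw [Multiset.eq_of_mem_replicate hb]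
  have hsum : (V.toList.formPerm * τ).cycleType.sum = n := by
    rw [ct, Multiset.filter_singleton]
    split_ifs with h
    · simp; omega
    · simp; omega
  refine ⟨V.toList.formPerm * τ, ?_, ?_, V, hV, ?_⟩
  · rw [even_iff, hsum, ct, Multiset.filter_singleton]
    split_ifs at hpar ⊢ with h
    · simp; omega
    · simp; omega
  · intro x
    rw [Perm.sum_cycleType] at hsum
    have : (V.toList.formPerm * τ).support = Finset.univ := by
      rw [← Finset.card_eq_iff_eq_univ]; simpa using hsum
    rw [← Perm.mem_support, this]; simp
  · intro x hx
    have h2 : τ (τ x) = x := by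
      rw [← Perm.mul_apply, ← pow_two, hτ]; rfl
    have h1 : τ x ∉ V := by
      intro h
      have h3 := t1 (τ x) (by simp [h])
      rw [h2] at h3
      rw [← h3] at h
      exact hx h
    have f : ∀ z, z ∉ V → V.toList.formPerm z = z := fun z hz =>
      List.formPerm_apply_of_notMem (by simpa using hz)
    simp [f _ h1, h2, f _ hx]

theorem n_k_l_eq_two_thirds_kl_add_one (k l : ℕ) (hk : 2 ≤ k) (hke : Even k)
    (hl : 3 < l) (hl3 : 3 ∣ l) :
    (∀ σ ∈ alternatingGroup (Fin (2 * k * l / 3 + 1)),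
      IsProdOfCycles (2 * k * l / 3 + 1) k l σ) ∧
    (∀ n : ℕ, 2 * k * l / 3 + 1 < n →
      ∃ σ ∈ alternatingGroup (Fin n), ¬ IsProdOfCycles n k l σ) := by
  obtain ⟨m, rfl⟩ := hl3
  obtain ⟨j, rfl⟩ := hke
  have e : 2 * (j + j) * (3 * m) / 3 = 4 * (j * m) := by
    rw [show 2 * (j + j) * (3 * m) = 3 * (4 * (j * m)) by ring]; simp
  rw [e]
  constructor
  · intro σ hσ
    have := lower (m := m) (by omega) j (by omega) _ le_rfl σ hσ (by
      rw [Perm.sum_cycleType]; simpa using Finset.card_le_univ σ.support)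
    rwa [two_mul] at this
  · intro n hn
    have main : ∀ r p, n = r + 2 * p → r ≠ 1 → (n + p + if 2 ≤ r then 1 else 0) % 2 = 0 →
        12 * (j * m) + r < 3 * n → ∃ σ ∈ alternatingGroup (Fin n),
          ¬ IsProdOfCycles n (j + j) (3 * m) σ := by
      intro r p h1 h2 h3 h4
      obtain ⟨σ, s1, s2, S, s3, s4⟩ := bad_perm n r p h1 h2 h3
      refine ⟨σ, s1, fun h => ?_⟩
      have := upper_ineq (by omega) σ h S s2 s4
      rw [show 2 * ((j + j) * (3 * m)) = 12 * (j * m) by ring] at this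
      omega
    have hq : 1 ≤ j * m := Nat.mul_pos (by omega) (by omega)
    generalize j * m = q at *
    rcases (by omega : n % 4 = 0 ∨ n % 4 = 1 ∨ n % 4 = 2 ∨ n % 4 = 3) with h | h | h | h
    · exact main 0 (n / 2) (by omega) (by omega) (by simp; omega) (by omega)
    · exact main 5 ((n - 5) / 2) (by omega) (by omega) (by simp; omega) (by omega)
    · exact main 4 ((n - 4) / 2) (by omega) (by omega) (by simp; omega) (by omega)
    · exact main 3 ((n - 3) / 2) (by omega) (by omega) (by simp; omega) (by omega)
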